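/- Let κ̄ > 0 and r ≥ 0, and let a, v: [0,∞) → ℂ be C¹ functions satisfying the ODE system a'(t) + r v(t) = 0 and v'(t) + r² v(t) − r(1 + κ̄r²) a(t) = 0 for all t ≥ 0. Then with c₁ = (1/2)min(1, κ̄) and C = max(3/2, κ̄+1)/min(1/2, κ̄), one has for all t ≥ 0: |a(t)|² + r²|a(t)|² + |v(t)|² ≤ C² e^{−c₁ r² t} ( |a(0)|² + r²|a(0)|² + |v(0)|² ). In particular, the Lyapunov functional L²(t) := (1 + κ̄r²)|a(t)|² + |v(t)|² + (1/2)( r²|a(t)|² − 2r Re(a(t) \overline{v(t)}) ) is comparable to |a|² + r²|a|² + |v|² (with comparison constants depending only on κ̄) and satisfies (d/dt)L²(t) + c₁ r² L²(t) ≤ 0. -/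

import Mathlib

noncomputable section

open Complex

/-- The Lyapunov functional
`L²(t) = (1+κ̄r²)|a(t)|² + |v(t)|² + (1/2)(r²|a(t)|² − 2r Re(a(t) conj v(t)))`. -/
def lyap (κ r : ℝ) (a v : ℝ → ℂ) (t : ℝ) : ℝ :=
  (1 + κ * r ^ 2) * normSq (a t) + normSq (v t) +
    (1 / 2) * (r ^ 2 * normSq (a t) - 2 * r * (a t * (starRingEnd ℂ) (v t)).re)

theorem lyap_eq_re_im (κ r : ℝ) (a v : ℝ → ℂ) (t : ℝ) :
    lyap κ r a v t =
      (1 + κ * r ^ 2) * ((a t).re ^ 2 + (a t).im ^ 2) + ((v t).re ^ 2 + (v t).im ^ 2) +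
        (1 / 2) * (r ^ 2 * ((a t).re ^ 2 + (a t).im ^ 2) -
          2 * r * ((a t).re * (v t).re + (a t).im * (v t).im)) := by
  simp only [lyap, normSq_apply, mul_re, conj_re, conj_im]
  ring

theorem abs_mul_re_mul_conj_le (r : ℝ) (z w : ℂ) :
    |2 * r * (z * (starRingEnd ℂ) w).re| ≤ r ^ 2 * normSq z + normSq w := by
  simp only [normSq_apply, mul_re, conj_re, conj_im]
  rw [abs_le]
  constructor <;>
    nlinarith [sq_nonneg (r * z.re + w.re), sq_nonneg (r * z.im + w.im),
      sq_nonneg (r * z.re - w.re), sq_nonneg (r * z.im - w.im)]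

theorem min_mul_le_lyap (κ r : ℝ) (a v : ℝ → ℂ) (t : ℝ) :
    min (1 / 2) κ * (normSq (a t) + r ^ 2 * normSq (a t) + normSq (v t)) ≤ lyap κ r a v t := by
  have h := (abs_le.1 (abs_mul_re_mul_conj_le r (a t) (v t))).2
  have hA := normSq_nonneg (a t)
  have hV := normSq_nonneg (v t)
  have hrA := mul_nonneg (sq_nonneg r) hA
  have h₁ := min_le_left (1 / 2) κ
  have h₂ := min_le_right (1 / 2) κ
  unfold lyap
  nlinarith [mul_le_mul_of_nonneg_right h₁ hA, mul_le_mul_of_nonneg_right h₁ hV,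
    mul_le_mul_of_nonneg_right h₂ hrA]

theorem lyap_le_max_mul (κ r : ℝ) (a v : ℝ → ℂ) (t : ℝ) :
    lyap κ r a v t ≤
      max (3 / 2) (κ + 1) * (normSq (a t) + r ^ 2 * normSq (a t) + normSq (v t)) := by
  have h := (abs_le.1 (abs_mul_re_mul_conj_le r (a t) (v t))).1
  have hA := normSq_nonneg (a t)
  have hV := normSq_nonneg (v t)
  have hrA := mul_nonneg (sq_nonneg r) hA
  have h₁ := le_max_left (3 / 2) (κ + 1)
  have h₂ := le_max_right (3 / 2) (κ + 1)
  unfold lyap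
  nlinarith [mul_le_mul_of_nonneg_right h₁ hA, mul_le_mul_of_nonneg_right h₁ hV,
    mul_le_mul_of_nonneg_right h₂ hrA]

theorem min_mul_lyap_le {κ : ℝ} (hκ : 0 < κ) (r : ℝ) (a v : ℝ → ℂ) (t : ℝ) :
    (1 / 2) * min 1 κ * lyap κ r a v t ≤ (1 + κ * r ^ 2) * normSq (a t) + normSq (v t) := by
  have h := (abs_le.1 (abs_mul_re_mul_conj_le r (a t) (v t))).1
  have hA := normSq_nonneg (a t)
  have hV := normSq_nonneg (v t)
  have hrA := mul_nonneg (sq_nonneg r) hA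
  have hm : 0 < min 1 κ := lt_min one_pos hκ
  have h₁ := min_le_left 1 κ
  have h₂ := min_le_right 1 κ
  have hL : lyap κ r a v t ≤ (normSq (a t) + κ * (r ^ 2 * normSq (a t)) + 2 * normSq (v t)) +
      r ^ 2 * normSq (a t) := by
    unfold lyap
    linarith
  have hB : 0 ≤ normSq (a t) + κ * (r ^ 2 * normSq (a t)) + 2 * normSq (v t) := by positivity
  linarith [mul_le_mul_of_nonneg_left hL hm.le, mul_le_mul_of_nonneg_right h₁ hB,
    mul_le_mul_of_nonneg_right h₂ hrA]

theorem hasDerivAt_lyap {κ r : ℝ} {a v : ℝ → ℂ} {t : ℝ}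
    (ha : HasDerivAt a (-((r : ℂ) * v t)) t)
    (hv : HasDerivAt v
      (-((r : ℂ) ^ 2 * v t) + ((r * (1 + κ * r ^ 2) : ℝ) : ℂ) * a t) t) :
    HasDerivAt (lyap κ r a v)
      (-(r ^ 2 * ((1 + κ * r ^ 2) * normSq (a t) + normSq (v t)))) t := by
  have har : HasDerivAt (fun s => (a s).re) _ t := reCLM.hasFDerivAt.comp_hasDerivAt t ha
  have hai : HasDerivAt (fun s => (a s).im) _ t := imCLM.hasFDerivAt.comp_hasDerivAt t ha
  have hvr : HasDerivAt (fun s => (v s).re) _ t := reCLM.hasFDerivAt.comp_hasDerivAt t hv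
  have hvi : HasDerivAt (fun s => (v s).im) _ t := imCLM.hasFDerivAt.comp_hasDerivAt t hv
  have hA := (har.pow 2).add (hai.pow 2)
  have h := ((hA.const_mul (1 + κ * r ^ 2)).add ((hvr.pow 2).add (hvi.pow 2))).add
    (((hA.const_mul (r ^ 2)).sub
      (((har.mul hvr).add (hai.mul hvi)).const_mul (2 * r))).const_mul (1 / 2))
  rw [funext (lyap_eq_re_im κ r a v)]
  refine h.congr_deriv ?_
  simp only [← ofReal_pow, reCLM_apply, imCLM_apply, neg_re, neg_im, add_re, add_im,
    re_ofReal_mul, im_ofReal_mul, normSq_apply]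
  push_cast
  ring

theorem exp_mul_antitoneOn {f f' : ℝ → ℝ} {c : ℝ}
    (hf : ∀ t, 0 ≤ t → HasDerivAt f (f' t) t) (hle : ∀ t, 0 ≤ t → f' t + c * f t ≤ 0) :
    AntitoneOn (fun t => Real.exp (c * t) * f t) (Set.Ici 0) := by
  have hd : ∀ t, 0 ≤ t → HasDerivAt (fun t => Real.exp (c * t) * f t)
      (Real.exp (c * t) * (f' t + c * f t)) t := fun t ht => by
    refine ((((hasDerivAt_id t).const_mul c).exp).mul (hf t ht)).congr_deriv ?_
    simp only [id]
    ring
  refine antitoneOn_of_hasDerivWithinAt_nonpos (convex_Ici 0)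
    (fun t ht => (hd t ht).continuousAt.continuousWithinAt)
    (fun t ht => (hd t (interior_subset ht)).hasDerivWithinAt) fun t ht => ?_
  exact mul_nonpos_of_nonneg_of_nonpos (Real.exp_pos _).le (hle t (interior_subset ht))

/-- Fourier-side energy estimate for the linearized Navier–Stokes–Korteweg system:
if `a' + r v = 0` and `v' + r² v − r(1+κ̄r²) a = 0` on `[0,∞)`, then with
`c₁ = (1/2)min(1,κ̄)` and `C = max(3/2, κ̄+1)/min(1/2, κ̄)` one has the exponential decay
`|a|² + r²|a|² + |v|² ≤ C² e^{−c₁r²t} (|a(0)|² + r²|a(0)|² + |v(0)|²)`; moreover the Lyapunov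
functional `L²` is comparable to `|a|² + r²|a|² + |v|²` (with constants depending only on `κ̄`)
and satisfies `(L²)' + c₁ r² L² ≤ 0`. -/
theorem lyapunov_decay_NSK (κ : ℝ) (hκ : 0 < κ) :
    ∃ c₂ C₂ : ℝ, 0 < c₂ ∧ 0 < C₂ ∧
      ∀ (r : ℝ), 0 ≤ r → ∀ (a v : ℝ → ℂ),
        (∀ t : ℝ, 0 ≤ t → HasDerivAt a (-((r : ℂ) * v t)) t) →
        (∀ t : ℝ, 0 ≤ t →
          HasDerivAt v (-((r : ℂ) ^ 2 * v t) + ((r * (1 + κ * r ^ 2) : ℝ) : ℂ) * a t) t) →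
        -- exponential decay, with the explicit constants of the statement
        (∀ t : ℝ, 0 ≤ t →
          normSq (a t) + r ^ 2 * normSq (a t) + normSq (v t) ≤
            (max (3 / 2) (κ + 1) / min (1 / 2) κ) ^ 2 *
              Real.exp (-((1 / 2) * min 1 κ) * r ^ 2 * t) *
              (normSq (a 0) + r ^ 2 * normSq (a 0) + normSq (v 0))) ∧
        -- comparability of the Lyapunov functional, constants depending only on κ̄
        (∀ t : ℝ, 0 ≤ t →
          c₂ * (normSq (a t) + r ^ 2 * normSq (a t) + normSq (v t)) ≤ lyap κ r a v t ∧
          lyap κ r a v t ≤ C₂ * (normSq (a t) + r ^ 2 * normSq (a t) + normSq (v t))) ∧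
        -- the differential inequality (d/dt)L² + c₁ r² L² ≤ 0
        (∀ t : ℝ, 0 ≤ t →
          deriv (lyap κ r a v) t + ((1 / 2) * min 1 κ) * r ^ 2 * lyap κ r a v t ≤ 0) := by
  have hm : 0 < min (1 / 2) κ := lt_min (by norm_num) hκ
  have hM : 0 < max (3 / 2) (κ + 1) := lt_max_of_lt_left (by norm_num)
  refine ⟨min (1 / 2) κ, max (3 / 2) (κ + 1), hm, hM, fun r _ a v ha hv => ?_⟩
  have hL := fun t ht => hasDerivAt_lyap (ha t ht) (hv t ht)
  have hdiff : ∀ t : ℝ, 0 ≤ t → -(r ^ 2 * ((1 + κ * r ^ 2) * normSq (a t) + normSq (v t))) +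
      (1 / 2) * min 1 κ * r ^ 2 * lyap κ r a v t ≤ 0 := fun t _ => by
    linarith [mul_le_mul_of_nonneg_left (min_mul_lyap_le hκ r a v t) (sq_nonneg r)]
  refine ⟨fun t ht => ?_, fun t _ => ⟨min_mul_le_lyap κ r a v t, lyap_le_max_mul κ r a v t⟩,
    fun t ht => (hL t ht).deriv ▸ hdiff t ht⟩
  have hE₀ : 0 ≤ normSq (a 0) + r ^ 2 * normSq (a 0) + normSq (v 0) := by
    have := normSq_nonneg (a 0)
    have := normSq_nonneg (v 0)
    positivity
  set E₀ := normSq (a 0) + r ^ 2 * normSq (a 0) + normSq (v 0)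
  set E := normSq (a t) + r ^ 2 * normSq (a t) + normSq (v t)
  set M := max (3 / 2) (κ + 1)
  set m := min (1 / 2) κ
  set e := Real.exp (-((1 / 2) * min 1 κ) * r ^ 2 * t) with he
  have hdecay : lyap κ r a v t ≤ e * lyap κ r a v 0 := by
    have h := exp_mul_antitoneOn hL hdiff Set.self_mem_Ici ht ht
    simp only [mul_zero, Real.exp_zero, one_mul] at h
    have h' := mul_le_mul_of_nonneg_left h (Real.exp_pos (-((1 / 2) * min 1 κ) * r ^ 2 * t)).le
    rwa [← mul_assoc, ← Real.exp_add, neg_mul, neg_mul, neg_add_cancel, Real.exp_zero, one_mul,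
      ← neg_mul, ← neg_mul, ← he] at h'
  have hC : 1 ≤ M / m := (one_le_div hm).2 <|
    ((min_le_left _ _).trans (by norm_num)).trans (le_max_left (3 / 2) (κ + 1))
  have hnonneg : 0 ≤ e * E₀ := mul_nonneg (Real.exp_pos _).le hE₀
  calc E ≤ M / m * (e * E₀) := by
        rw [div_mul_eq_mul_div, le_div_iff₀ hm, mul_comm E]
        calc m * E ≤ lyap κ r a v t := min_mul_le_lyap κ r a v t
          _ ≤ e * lyap κ r a v 0 := hdecay
          _ ≤ e * (M * E₀) :=
            mul_le_mul_of_nonneg_left (lyap_le_max_mul κ r a v 0) (Real.exp_pos _).le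
          _ = M * (e * E₀) := by ring
    _ ≤ (M / m) ^ 2 * (e * E₀) :=
        mul_le_mul_of_nonneg_right (le_self_pow₀ hC two_ne_zero) hnonneg
    _ = (M / m) ^ 2 * e * E₀ := by ring
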